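/- Let C₀, C₁, C₂ be chain complexes of modules over 𝔽 = ℤ/2ℤ indexed cyclically by n ∈ ℤ/3ℤ, let fₙ : Cₙ → Cₙ₊₁ be chain maps, and for each n let Hₙ be a chain homotopy from fₙ₊₁ ∘ fₙ to the zero chain map, so that ∂ ∘ Hₙ + Hₙ ∘ ∂ = fₙ₊₁ ∘ fₙ. Suppose that for each n the chain map ψₙ := fₙ₊₂ ∘ Hₙ + Hₙ₊₁ ∘ fₙ : Cₙ → Cₙ is a quasi-isomorphism (induces an isomorphism on homology in every degree). Then the induced sequence on homology ⋯ → H_k(Cₙ₋₁) → H_k(Cₙ) → H_k(Cₙ₊₁) → ⋯ is exact: for every n ∈ ℤ/3ℤ and every degree k ∈ ℤ, the image of the map H_k(fₙ₋₁) : H_k(Cₙ₋₁) → H_k(Cₙ) equals the kernel of H_k(fₙ) : H_k(Cₙ) → H_k(Cₙ₊₁). -/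

import Mathlib

section Homology

variable {A B C A' B' C' : Type}
  [AddCommGroup A] [AddCommGroup B] [AddCommGroup C]
  [AddCommGroup A'] [AddCommGroup B'] [AddCommGroup C']
  [Module (ZMod 2) A] [Module (ZMod 2) B] [Module (ZMod 2) C]
  [Module (ZMod 2) A'] [Module (ZMod 2) B'] [Module (ZMod 2) C']

/-- Homology of a two-step complex `A → B → C`: cycles in `B` modulo boundaries. -/
def homologyOf (dIn : A →ₗ[ZMod 2] B) (dOut : B →ₗ[ZMod 2] C) : Type :=
  LinearMap.ker dOut ⧸ (LinearMap.range dIn).comap (LinearMap.ker dOut).subtype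

instance (dIn : A →ₗ[ZMod 2] B) (dOut : B →ₗ[ZMod 2] C) :
    AddCommGroup (homologyOf dIn dOut) :=
  inferInstanceAs (AddCommGroup (LinearMap.ker dOut ⧸
    (LinearMap.range dIn).comap (LinearMap.ker dOut).subtype))

instance (dIn : A →ₗ[ZMod 2] B) (dOut : B →ₗ[ZMod 2] C) :
    Module (ZMod 2) (homologyOf dIn dOut) :=
  inferInstanceAs (Module (ZMod 2) (LinearMap.ker dOut ⧸
    (LinearMap.range dIn).comap (LinearMap.ker dOut).subtype))

/-- The map induced on homology by a commuting square of chain maps. -/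
def homologyMap (dIn : A →ₗ[ZMod 2] B) (dOut : B →ₗ[ZMod 2] C)
    (dIn' : A' →ₗ[ZMod 2] B') (dOut' : B' →ₗ[ZMod 2] C')
    (fA : A →ₗ[ZMod 2] A') (fB : B →ₗ[ZMod 2] B') (fC : C →ₗ[ZMod 2] C')
    (h1 : fB.comp dIn = dIn'.comp fA) (h2 : dOut'.comp fB = fC.comp dOut) :
    homologyOf dIn dOut →ₗ[ZMod 2] homologyOf dIn' dOut' :=
  Submodule.mapQ _ _
    (fB.restrict (p := LinearMap.ker dOut) (q := LinearMap.ker dOut')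
      (fun x hx => by
        have hx' : dOut x = 0 := hx
        have := LinearMap.ext_iff.mp h2 x
        simp only [LinearMap.comp_apply] at this
        simp only [LinearMap.mem_ker, this, hx', map_zero]))
    (by
      rintro ⟨x, hxker⟩ hx
      simp only [Submodule.mem_comap, Submodule.subtype_apply] at hx ⊢
      obtain ⟨a, ha⟩ := hx
      refine ⟨fA a, ?_⟩
      have := LinearMap.ext_iff.mp h1 a
      simp only [LinearMap.comp_apply] at this
      rw [LinearMap.restrict_apply]
      simp only [← this, ha])

end Homology

section HomologyClass

variable {A B C A' B' C' : Type}
  [AddCommGroup A] [AddCommGroup B] [AddCommGroup C]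
  [AddCommGroup A'] [AddCommGroup B'] [AddCommGroup C']
  [Module (ZMod 2) A] [Module (ZMod 2) B] [Module (ZMod 2) C]
  [Module (ZMod 2) A'] [Module (ZMod 2) B'] [Module (ZMod 2) C']

/-- The homology class of a cycle. -/
def homologyClass (dIn : A →ₗ[ZMod 2] B) (dOut : B →ₗ[ZMod 2] C) (x : B) (hx : dOut x = 0) :
    homologyOf dIn dOut :=
  Submodule.Quotient.mk (p := (LinearMap.range dIn).comap (LinearMap.ker dOut).subtype) ⟨x, hx⟩

theorem exists_homologyClass_eq {dIn : A →ₗ[ZMod 2] B} {dOut : B →ₗ[ZMod 2] C}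
    (c : homologyOf dIn dOut) : ∃ x hx, homologyClass dIn dOut x hx = c := by
  obtain ⟨⟨x, hx⟩, rfl⟩ := Submodule.Quotient.mk_surjective _ c
  exact ⟨x, hx, rfl⟩

theorem homologyClass_eq_iff {dIn : A →ₗ[ZMod 2] B} {dOut : B →ₗ[ZMod 2] C} {x y : B}
    {hx : dOut x = 0} {hy : dOut y = 0} :
    homologyClass dIn dOut x hx = homologyClass dIn dOut y hy ↔ ∃ a, dIn a = x - y :=
  Submodule.Quotient.eq _

theorem homologyClass_eq_zero_iff {dIn : A →ₗ[ZMod 2] B} {dOut : B →ₗ[ZMod 2] C} {x : B}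
    {hx : dOut x = 0} : homologyClass dIn dOut x hx = 0 ↔ ∃ a, dIn a = x :=
  Submodule.Quotient.mk_eq_zero _

theorem homologyMap_homologyClass {dIn : A →ₗ[ZMod 2] B} {dOut : B →ₗ[ZMod 2] C}
    {dIn' : A' →ₗ[ZMod 2] B'} {dOut' : B' →ₗ[ZMod 2] C'}
    {fA : A →ₗ[ZMod 2] A'} {fB : B →ₗ[ZMod 2] B'} {fC : C →ₗ[ZMod 2] C'}
    (h1 : fB.comp dIn = dIn'.comp fA) (h2 : dOut'.comp fB = fC.comp dOut)
    (x : B) (hx : dOut x = 0) (hx' : dOut' (fB x) = 0) :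
    homologyMap dIn dOut dIn' dOut' fA fB fC h1 h2 (homologyClass dIn dOut x hx) =
      homologyClass dIn' dOut' (fB x) hx' :=
  rfl

end HomologyClass

/-- Exactness at `C1` of the triangle detection lemma. It suffices that `ψ0` is surjective and `ψ1`
is injective on homology. -/
theorem range_homologyMap_eq_ker_of_nullhomotopic
    {C0 C1 C2 : ℤ → Type}
    [∀ k, AddCommGroup (C0 k)] [∀ k, AddCommGroup (C1 k)] [∀ k, AddCommGroup (C2 k)]
    [∀ k, Module (ZMod 2) (C0 k)] [∀ k, Module (ZMod 2) (C1 k)]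
    [∀ k, Module (ZMod 2) (C2 k)]
    {d0 : ∀ k : ℤ, C0 (k + 1) →ₗ[ZMod 2] C0 k}
    {d1 : ∀ k : ℤ, C1 (k + 1) →ₗ[ZMod 2] C1 k}
    {d2 : ∀ k : ℤ, C2 (k + 1) →ₗ[ZMod 2] C2 k}
    {f0 : ∀ k : ℤ, C0 k →ₗ[ZMod 2] C1 k}
    {f1 : ∀ k : ℤ, C1 k →ₗ[ZMod 2] C2 k}
    {f2 : ∀ k : ℤ, C2 k →ₗ[ZMod 2] C0 k}
    (hf0 : ∀ k, (f0 k).comp (d0 k) = (d1 k).comp (f0 (k + 1)))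
    (hf1 : ∀ k, (f1 k).comp (d1 k) = (d2 k).comp (f1 (k + 1)))
    (hf2 : ∀ k, (f2 k).comp (d2 k) = (d0 k).comp (f2 (k + 1)))
    {H0 : ∀ k : ℤ, C0 k →ₗ[ZMod 2] C2 (k + 1)}
    {H1 : ∀ k : ℤ, C1 k →ₗ[ZMod 2] C0 (k + 1)}
    {H2 : ∀ k : ℤ, C2 k →ₗ[ZMod 2] C1 (k + 1)}
    (hH0 : ∀ k, (d2 (k + 1)).comp (H0 (k + 1)) + (H0 k).comp (d0 k) =
      (f1 (k + 1)).comp (f0 (k + 1)))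
    (hH1 : ∀ k, (d0 (k + 1)).comp (H1 (k + 1)) + (H1 k).comp (d1 k) =
      (f2 (k + 1)).comp (f1 (k + 1)))
    (hH2 : ∀ k, (d1 (k + 1)).comp (H2 (k + 1)) + (H2 k).comp (d2 k) =
      (f0 (k + 1)).comp (f2 (k + 1)))
    {ψ0 : ∀ k : ℤ, C0 k →ₗ[ZMod 2] C0 (k + 1)}
    {ψ1 : ∀ k : ℤ, C1 k →ₗ[ZMod 2] C1 (k + 1)}
    (hψ0def : ∀ k, ψ0 k = (f2 (k + 1)).comp (H0 k) + (H1 k).comp (f0 k))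
    (hψ1def : ∀ k, ψ1 k = (f0 (k + 1)).comp (H1 k) + (H2 k).comp (f1 k))
    (hψ0chain : ∀ k, (d0 (k + 1)).comp (ψ0 (k + 1)) = (ψ0 k).comp (d0 k))
    (hψ1chain : ∀ k, (d1 (k + 1)).comp (ψ1 (k + 1)) = (ψ1 k).comp (d1 k))
    (k : ℤ)
    (hψ0surj : Function.Surjective
      (homologyMap (d0 (k + 1)) (d0 k) (d0 (k + 1 + 1)) (d0 (k + 1))
        (ψ0 (k + 1 + 1)) (ψ0 (k + 1)) (ψ0 k) (hψ0chain (k + 1)).symm (hψ0chain k)))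
    (hψ1inj : Function.Injective
      (homologyMap (d1 (k + 1)) (d1 k) (d1 (k + 1 + 1)) (d1 (k + 1))
        (ψ1 (k + 1 + 1)) (ψ1 (k + 1)) (ψ1 k) (hψ1chain (k + 1)).symm (hψ1chain k))) :
    LinearMap.range (homologyMap (d0 (k + 1)) (d0 k) (d1 (k + 1)) (d1 k)
        (f0 (k + 1 + 1)) (f0 (k + 1)) (f0 k) (hf0 (k + 1)) (hf0 k).symm) =
      LinearMap.ker (homologyMap (d1 (k + 1)) (d1 k) (d2 (k + 1)) (d2 k)
        (f1 (k + 1 + 1)) (f1 (k + 1)) (f1 k) (hf1 (k + 1)) (hf1 k).symm) := by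
  replace hf0 k x : f0 k (d0 k x) = d1 k (f0 (k + 1) x) := LinearMap.congr_fun (hf0 k) x
  replace hf1 k x : f1 k (d1 k x) = d2 k (f1 (k + 1) x) := LinearMap.congr_fun (hf1 k) x
  replace hf2 k x : f2 k (d2 k x) = d0 k (f2 (k + 1) x) := LinearMap.congr_fun (hf2 k) x
  replace hH0 k x : d2 (k + 1) (H0 (k + 1) x) + H0 k (d0 k x) = f1 (k + 1) (f0 (k + 1) x) :=
    LinearMap.congr_fun (hH0 k) x
  replace hH1 k x : d0 (k + 1) (H1 (k + 1) x) + H1 k (d1 k x) = f2 (k + 1) (f1 (k + 1) x) :=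
    LinearMap.congr_fun (hH1 k) x
  replace hH2 k x : d1 (k + 1) (H2 (k + 1) x) + H2 k (d2 k x) = f0 (k + 1) (f2 (k + 1) x) :=
    LinearMap.congr_fun (hH2 k) x
  replace hψ0def k x : ψ0 k x = f2 (k + 1) (H0 k x) + H1 k (f0 k x) :=
    LinearMap.congr_fun (hψ0def k) x
  replace hψ1def k x : ψ1 k x = f0 (k + 1) (H1 k x) + H2 k (f1 k x) :=
    LinearMap.congr_fun (hψ1def k) x
  have hψ0d k x : d0 (k + 1) (ψ0 (k + 1) x) = ψ0 k (d0 k x) := LinearMap.congr_fun (hψ0chain k) x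
  have hψ1d k x : d1 (k + 1) (ψ1 (k + 1) x) = ψ1 k (d1 k x) := LinearMap.congr_fun (hψ1chain k) x
  ext c
  obtain ⟨x, hx, rfl⟩ := exists_homologyClass_eq c
  have hf1x : d2 k (f1 (k + 1) x) = 0 := by rw [← hf1, hx, map_zero]
  rw [LinearMap.mem_ker, homologyMap_homologyClass _ _ x hx hf1x, homologyClass_eq_zero_iff]
  constructor
  · rintro ⟨w, hw⟩
    obtain ⟨w, hw0, rfl⟩ := exists_homologyClass_eq w
    have hf0w : d1 k (f0 (k + 1) w) = 0 := by rw [← hf0, hw0, map_zero]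
    rw [homologyMap_homologyClass _ _ w hw0 hf0w, homologyClass_eq_iff] at hw
    obtain ⟨b, hb⟩ := hw
    refine ⟨H0 (k + 1) w - f1 (k + 1 + 1) b, ?_⟩
    have h := hH0 k w
    rw [hw0, map_zero, add_zero] at h
    rw [map_sub, ← hf1, hb, h, map_sub, sub_sub_cancel]
  · rintro ⟨y, hy⟩
    have hz : d0 (k + 1) (H1 (k + 1) x + f2 (k + 1 + 1) y) = 0 := by
      have h := hH1 k x
      rw [hx, map_zero, add_zero] at h
      rw [map_add, ← hf2, hy, h, ZModModule.add_self]
    obtain ⟨w, hw⟩ := hψ0surj (homologyClass _ _ _ hz)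
    obtain ⟨w, hw0, rfl⟩ := exists_homologyClass_eq w
    have hψ0w : d0 (k + 1) (ψ0 (k + 1) w) = 0 := by rw [hψ0d, hw0, map_zero]
    rw [homologyMap_homologyClass _ _ w hw0 hψ0w, homologyClass_eq_iff] at hw
    obtain ⟨a, ha⟩ := hw
    have hf0w : d1 k (f0 (k + 1) w) = 0 := by rw [← hf0, hw0, map_zero]
    refine ⟨homologyClass _ _ w hw0, hψ1inj ?_⟩
    rw [homologyMap_homologyClass _ _ w hw0 hf0w,
      homologyMap_homologyClass _ _ _ hf0w (by rw [hψ1d, hf0w, map_zero]),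
      homologyMap_homologyClass _ _ x hx (by rw [hψ1d, hx, map_zero]), homologyClass_eq_iff]
    refine ⟨f0 (k + 1 + 1 + 1) a - H2 (k + 1 + 1) y - H2 (k + 1 + 1) (H0 (k + 1) w), ?_⟩
    have h0 := hH0 k w
    rw [hw0, map_zero, add_zero] at h0
    have h2y := hH2 (k + 1) y
    have h2w := hH2 (k + 1) (H0 (k + 1) w)
    rw [hy] at h2y
    rw [h0] at h2w
    rw [map_sub, map_sub, ← hf0, ha, hψ1def, hψ1def, map_sub, hψ0def, map_add, map_add,
      ← h2y, ← h2w]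
    simp only [ZModModule.sub_eq_add]
    abel_nf
    simp [two_smul, ZModModule.add_self]

/-- Three chain complexes `C0, C1, C2` of `ℤ/2ℤ`-modules indexed cyclically by
`n ∈ ℤ/3ℤ`, chain maps `fn : Cn → C(n+1)`, and chain homotopies `Hn` from
`f(n+1) ∘ fn` to zero.  Suppose each chain map `ψn = f(n+2) ∘ Hn + H(n+1) ∘ fn`
is a quasi-isomorphism (induces an isomorphism on homology in every degree).
Then the induced sequence on homology
`⋯ → H_k(C(n-1)) → H_k(Cn) → H_k(C(n+1)) → ⋯` is exact: the image of each induced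
map equals the kernel of the next. -/
theorem stmt_1
    (C0 C1 C2 : ℤ → Type)
    [∀ k, AddCommGroup (C0 k)] [∀ k, AddCommGroup (C1 k)] [∀ k, AddCommGroup (C2 k)]
    [∀ k, Module (ZMod 2) (C0 k)] [∀ k, Module (ZMod 2) (C1 k)]
    [∀ k, Module (ZMod 2) (C2 k)]
    (d0 : ∀ k : ℤ, C0 (k + 1) →ₗ[ZMod 2] C0 k)
    (d1 : ∀ k : ℤ, C1 (k + 1) →ₗ[ZMod 2] C1 k)
    (d2 : ∀ k : ℤ, C2 (k + 1) →ₗ[ZMod 2] C2 k)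
    (hd0 : ∀ k, (d0 k).comp (d0 (k + 1)) = 0)
    (hd1 : ∀ k, (d1 k).comp (d1 (k + 1)) = 0)
    (hd2 : ∀ k, (d2 k).comp (d2 (k + 1)) = 0)
    (f0 : ∀ k : ℤ, C0 k →ₗ[ZMod 2] C1 k)
    (f1 : ∀ k : ℤ, C1 k →ₗ[ZMod 2] C2 k)
    (f2 : ∀ k : ℤ, C2 k →ₗ[ZMod 2] C0 k)
    (hf0 : ∀ k, (f0 k).comp (d0 k) = (d1 k).comp (f0 (k + 1)))
    (hf1 : ∀ k, (f1 k).comp (d1 k) = (d2 k).comp (f1 (k + 1)))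
    (hf2 : ∀ k, (f2 k).comp (d2 k) = (d0 k).comp (f2 (k + 1)))
    (H0 : ∀ k : ℤ, C0 k →ₗ[ZMod 2] C2 (k + 1))
    (H1 : ∀ k : ℤ, C1 k →ₗ[ZMod 2] C0 (k + 1))
    (H2 : ∀ k : ℤ, C2 k →ₗ[ZMod 2] C1 (k + 1))
    (hH0 : ∀ k, (d2 (k + 1)).comp (H0 (k + 1)) + (H0 k).comp (d0 k) =
      (f1 (k + 1)).comp (f0 (k + 1)))
    (hH1 : ∀ k, (d0 (k + 1)).comp (H1 (k + 1)) + (H1 k).comp (d1 k) =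
      (f2 (k + 1)).comp (f1 (k + 1)))
    (hH2 : ∀ k, (d1 (k + 1)).comp (H2 (k + 1)) + (H2 k).comp (d2 k) =
      (f0 (k + 1)).comp (f2 (k + 1)))
    -- the maps `ψn = f(n+2) ∘ Hn + H(n+1) ∘ fn`, which are chain maps:
    (ψ0 : ∀ k : ℤ, C0 k →ₗ[ZMod 2] C0 (k + 1))
    (ψ1 : ∀ k : ℤ, C1 k →ₗ[ZMod 2] C1 (k + 1))
    (ψ2 : ∀ k : ℤ, C2 k →ₗ[ZMod 2] C2 (k + 1))
    (hψ0def : ∀ k, ψ0 k = (f2 (k + 1)).comp (H0 k) + (H1 k).comp (f0 k))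
    (hψ1def : ∀ k, ψ1 k = (f0 (k + 1)).comp (H1 k) + (H2 k).comp (f1 k))
    (hψ2def : ∀ k, ψ2 k = (f1 (k + 1)).comp (H2 k) + (H0 k).comp (f2 k))
    (hψ0chain : ∀ k, (d0 (k + 1)).comp (ψ0 (k + 1)) = (ψ0 k).comp (d0 k))
    (hψ1chain : ∀ k, (d1 (k + 1)).comp (ψ1 (k + 1)) = (ψ1 k).comp (d1 k))
    (hψ2chain : ∀ k, (d2 (k + 1)).comp (ψ2 (k + 1)) = (ψ2 k).comp (d2 k))
    -- each `ψn` is a quasi-isomorphism: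
    (hψ0quasi : ∀ k, Function.Bijective
      (homologyMap (d0 (k + 1)) (d0 k) (d0 (k + 1 + 1)) (d0 (k + 1))
        (ψ0 (k + 1 + 1)) (ψ0 (k + 1)) (ψ0 k)
        ((hψ0chain (k + 1)).symm) (hψ0chain k)))
    (hψ1quasi : ∀ k, Function.Bijective
      (homologyMap (d1 (k + 1)) (d1 k) (d1 (k + 1 + 1)) (d1 (k + 1))
        (ψ1 (k + 1 + 1)) (ψ1 (k + 1)) (ψ1 k)
        ((hψ1chain (k + 1)).symm) (hψ1chain k)))
    (hψ2quasi : ∀ k, Function.Bijective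
      (homologyMap (d2 (k + 1)) (d2 k) (d2 (k + 1 + 1)) (d2 (k + 1))
        (ψ2 (k + 1 + 1)) (ψ2 (k + 1)) (ψ2 k)
        ((hψ2chain (k + 1)).symm) (hψ2chain k))) :
    -- exactness of the induced sequence on homology, in every degree:
    ∀ k : ℤ,
      LinearMap.range (homologyMap (d0 (k + 1)) (d0 k) (d1 (k + 1)) (d1 k)
          (f0 (k + 1 + 1)) (f0 (k + 1)) (f0 k) (hf0 (k + 1)) (hf0 k).symm) =
        LinearMap.ker (homologyMap (d1 (k + 1)) (d1 k) (d2 (k + 1)) (d2 k)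
          (f1 (k + 1 + 1)) (f1 (k + 1)) (f1 k) (hf1 (k + 1)) (hf1 k).symm) ∧
      LinearMap.range (homologyMap (d1 (k + 1)) (d1 k) (d2 (k + 1)) (d2 k)
          (f1 (k + 1 + 1)) (f1 (k + 1)) (f1 k) (hf1 (k + 1)) (hf1 k).symm) =
        LinearMap.ker (homologyMap (d2 (k + 1)) (d2 k) (d0 (k + 1)) (d0 k)
          (f2 (k + 1 + 1)) (f2 (k + 1)) (f2 k) (hf2 (k + 1)) (hf2 k).symm) ∧
      LinearMap.range (homologyMap (d2 (k + 1)) (d2 k) (d0 (k + 1)) (d0 k)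
          (f2 (k + 1 + 1)) (f2 (k + 1)) (f2 k) (hf2 (k + 1)) (hf2 k).symm) =
        LinearMap.ker (homologyMap (d0 (k + 1)) (d0 k) (d1 (k + 1)) (d1 k)
          (f0 (k + 1 + 1)) (f0 (k + 1)) (f0 k) (hf0 (k + 1)) (hf0 k).symm) := by
  intro k
  exact ⟨range_homologyMap_eq_ker_of_nullhomotopic hf0 hf1 hf2 hH0 hH1 hH2 hψ0def hψ1def
      hψ0chain hψ1chain k (hψ0quasi k).surjective (hψ1quasi k).injective,
    range_homologyMap_eq_ker_of_nullhomotopic hf1 hf2 hf0 hH1 hH2 hH0 hψ1def hψ2def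
      hψ1chain hψ2chain k (hψ1quasi k).surjective (hψ2quasi k).injective,
    range_homologyMap_eq_ker_of_nullhomotopic hf2 hf0 hf1 hH2 hH0 hH1 hψ2def hψ0def
      hψ2chain hψ0chain k (hψ2quasi k).surjective (hψ0quasi k).injective⟩
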